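/- Let n ≥ 2 and let P(x₁,…,xₙ) = γ·x₁^{α₁}⋯xₙ^{αₙ} be a generalized Cobb–Douglas production function on ℝⁿ₊, with γ > 0 and nonzero real exponents α₁,…,αₙ. Then the Hessian determinant det(P_ij) vanishes at some (equivalently, at every) point of ℝⁿ₊ if and only if α₁ + α₂ + ⋯ + αₙ = 1. -/

import Mathlib

open Real

/-- Partial derivative of `f` in the `i`-th coordinate direction. -/
noncomputable def pd {n : ℕ} (i : Fin n) (f : (Fin n → ℝ) → ℝ) (x : Fin n → ℝ) : ℝ :=
  fderiv ℝ f x (Pi.single i 1)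

/-- Hessian matrix of second partial derivatives of `f` at `x`. -/
noncomputable def hess {n : ℕ} (f : (Fin n → ℝ) → ℝ) (x : Fin n → ℝ) :
    Matrix (Fin n) (Fin n) ℝ :=
  fun i j => pd i (pd j f) x

/-- Hessian determinant `det(f_ij)` of `f` at `x`. -/
noncomputable def hessDet {n : ℕ} (f : (Fin n → ℝ) → ℝ) (x : Fin n → ℝ) : ℝ :=
  (hess f x).det

/-- The open positive orthant `ℝⁿ₊`. -/
def posOrth (n : ℕ) : Set (Fin n → ℝ) := {x | ∀ i, 0 < x i}

lemma posOrth_open (n : ℕ) : IsOpen (posOrth n) := by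
  have : posOrth n = ⋂ i, {x : Fin n → ℝ | 0 < x i} := by
    ext x; simp [posOrth]
  rw [this]
  exact isOpen_iInter_of_finite fun i => isOpen_lt continuous_const (continuous_apply i)

/-- The Cobb–Douglas function. -/
noncomputable def cobb {n : ℕ} (γ : ℝ) (α : Fin n → ℝ) (y : Fin n → ℝ) : ℝ :=
  γ * ∏ i, y i ^ α i

lemma cobb_hasFDerivAt {n : ℕ} (γ : ℝ) (α x : Fin n → ℝ) (hx : x ∈ posOrth n) :
    HasFDerivAt (cobb γ α)
      (cobb γ α x • ∑ i, (α i / x i) • (ContinuousLinearMap.proj i : (Fin n → ℝ) →L[ℝ] ℝ)) x := by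
  have key : ∀ y ∈ posOrth n, cobb γ α y = γ * Real.exp (∑ i, α i * Real.log (y i)) := by
    intro y hy
    rw [cobb, Real.exp_sum]
    congr 1
    refine Finset.prod_congr rfl fun i _ => ?_
    rw [Real.rpow_def_of_pos (hy i), mul_comm]
  have h1 : HasFDerivAt (fun y : Fin n → ℝ => ∑ i, α i * Real.log (y i))
      (∑ i, (α i / x i) • (ContinuousLinearMap.proj i : (Fin n → ℝ) →L[ℝ] ℝ)) x := by
    refine HasFDerivAt.fun_sum fun i _ => ?_
    have h := (((ContinuousLinearMap.proj i : (Fin n → ℝ) →L[ℝ] ℝ).hasFDerivAt (x := x)).log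
      (hx i).ne').const_mul (α i)
    rw [smul_smul] at h
    exact h
  have h2 := (h1.exp).const_mul γ
  rw [smul_smul, ← key x hx] at h2
  refine h2.congr_of_eventuallyEq ?_
  filter_upwards [(posOrth_open n).mem_nhds hx] with y hy using key y hy

lemma cobb_pd {n : ℕ} (γ : ℝ) (α x : Fin n → ℝ) (hx : x ∈ posOrth n) (j : Fin n) :
    pd j (cobb γ α) x = cobb γ α x * (α j / x j) := by
  rw [pd, (cobb_hasFDerivAt γ α x hx).fderiv]
  simp [Pi.single_apply]

lemma cobb_hess {n : ℕ} (γ : ℝ) (α x : Fin n → ℝ) (hx : x ∈ posOrth n) (i j : Fin n) :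
    hess (cobb γ α) x i j =
      (-(cobb γ α x) * α i / x i) * ((1 / x j) *
        ((1 : Matrix (Fin n) (Fin n) ℝ) i j - α j)) := by
  have he : pd j (cobb γ α) =ᶠ[nhds x] fun y => cobb γ α y * (α j * (y j)⁻¹) := by
    filter_upwards [(posOrth_open n).mem_nhds hx] with y hy
    rw [cobb_pd γ α y hy, div_eq_mul_inv]
  have hj := (hx j).ne'
  have hi := (hx i).ne'
  have hinv : HasFDerivAt (fun y : Fin n → ℝ => (y j)⁻¹) _ x :=
    (hasDerivAt_inv hj).comp_hasFDerivAt x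
      ((ContinuousLinearMap.proj j : (Fin n → ℝ) →L[ℝ] ℝ).hasFDerivAt (x := x))
  have h := (cobb_hasFDerivAt γ α x hx).mul (hinv.const_mul (α j))
  have h' := h.congr_of_eventuallyEq he
  rw [hess, pd, h'.fderiv]
  by_cases hij : i = j
  · subst hij
    simp [Pi.single_apply]
    field_simp
    ring
  · have hji : ¬ j = i := fun h => hij h.symm
    simp [Pi.single_apply, hij, hji]
    field_simp

lemma cobb_hessDet {n : ℕ} (γ : ℝ) (α x : Fin n → ℝ) (hx : x ∈ posOrth n) :
    hessDet (cobb γ α) x =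
      (∏ i, (-(cobb γ α x) * α i / x i)) * ((∏ j, (1 / x j)) * (1 - ∑ i, α i)) := by
  have hd : (Matrix.of fun i j => (1 : Matrix (Fin n) (Fin n) ℝ) i j - α j).det
      = 1 - ∑ i, α i := by
    have h := Matrix.det_one_add_replicateCol_mul_replicateRow (ι := Unit)
      (fun _ : Fin n => (-1 : ℝ)) α
    have e : (Matrix.of fun i j => (1 : Matrix (Fin n) (Fin n) ℝ) i j - α j) =
        1 + Matrix.replicateCol Unit (fun _ : Fin n => (-1 : ℝ)) * Matrix.replicateRow Unit α := by
      ext i j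
      simp [Matrix.mul_apply, sub_eq_add_neg]
    rw [e, h]
    simp [dotProduct, sub_eq_add_neg]
  rw [← hd, ← Matrix.det_mul_row, ← Matrix.det_mul_column, hessDet]
  congr 1
  ext i j
  rw [cobb_hess γ α x hx]
  rfl

lemma cobb_iff {n : ℕ} (γ : ℝ) (hγ : 0 < γ) (α x : Fin n → ℝ) (hα : ∀ i, α i ≠ 0)
    (hx : x ∈ posOrth n) :
    hessDet (fun y => γ * ∏ i, y i ^ α i) x = 0 ↔ ∑ i, α i = 1 := by
  have hP : cobb γ α x ≠ 0 :=
    (mul_pos hγ (Finset.prod_pos fun i _ => Real.rpow_pos_of_pos (hx i) _)).ne'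
  have h1 : (∏ i, (-(cobb γ α x) * α i / x i)) ≠ 0 :=
    Finset.prod_ne_zero_iff.2 fun i _ =>
      div_ne_zero (mul_ne_zero (neg_ne_zero.2 hP) (hα i)) (hx i).ne'
  have h2 : (∏ j, (1 / x j)) ≠ 0 :=
    Finset.prod_ne_zero_iff.2 fun i _ => one_div_ne_zero (hx i).ne'
  change hessDet (cobb γ α) x = 0 ↔ _
  rw [cobb_hessDet γ α x hx, mul_eq_zero, mul_eq_zero, or_iff_right h1, or_iff_right h2,
    sub_eq_zero, eq_comm]

/-- For the generalized Cobb–Douglas function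
`P(x) = γ·x₁^{α₁}⋯xₙ^{αₙ}` on `ℝⁿ₊` (`n ≥ 2`, `γ > 0`, all `αᵢ ≠ 0`), the Hessian
determinant `det(P_ij)` vanishes at some (equivalently, at every) point of `ℝⁿ₊`
iff `α₁ + ⋯ + αₙ = 1`. -/
theorem stmt_18 {n : ℕ} (hn : 2 ≤ n) (γ : ℝ) (hγ : 0 < γ)
    (α : Fin n → ℝ) (hα : ∀ i, α i ≠ 0) :
    ((∃ x ∈ posOrth n, hessDet (fun y => γ * ∏ i, y i ^ α i) x = 0) ↔
        (∑ i, α i) = 1) ∧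
    ((∀ x ∈ posOrth n, hessDet (fun y => γ * ∏ i, y i ^ α i) x = 0) ↔
        (∑ i, α i) = 1) := by
  have hone : (fun _ => 1 : Fin n → ℝ) ∈ posOrth n := fun _ => one_pos
  refine ⟨⟨?_, fun h => ⟨_, hone, (cobb_iff γ hγ α _ hα hone).2 h⟩⟩,
    ⟨fun h => (cobb_iff γ hγ α _ hα hone).1 (h _ hone), fun h x hx =>
      (cobb_iff γ hγ α x hα hx).2 h⟩⟩
  rintro ⟨x, hx, h⟩
  exact (cobb_iff γ hγ α x hα hx).1 h
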